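/- arXiv:1705.08500 — 6 statements merged into one kernel-verified Lean document; each statement's English description precedes it below -/
import Mathlib

section
/- Fix integers m and k with k < m. The function b ↦ Σ_{j=0}^{k} C(m,j)·b^j·(1−b)^{m−j} is differentiable on (0,1), and its derivative at any b ∈ (0,1) equals −(m−k)·C(m,k)·b^k·(1−b)^{m−k−1}. -/
/-- The binomial tail polynomial `P(n,k,b) = ∑_{j=0}^{k} C(n,j) b^j (1-b)^(n-j)`,
the probability that a `Binomial(n,b)` random variable is at most `k`. -/
noncomputable def binTail (n k : ℕ) (b : ℝ) : ℝ :=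
  ∑ j ∈ Finset.range (k + 1), (n.choose j : ℝ) * b ^ j * (1 - b) ^ (n - j)

/-- The derivative of a single binomial term `c * x ^ i * (1 - x) ^ j`. -/
theorem hasDerivAt_const_mul_pow_mul_one_sub_pow (c : ℝ) (i j : ℕ) (b : ℝ) :
    HasDerivAt (fun x : ℝ => c * x ^ i * (1 - x) ^ j)
      (c * (i * b ^ (i - 1)) * (1 - b) ^ j - c * b ^ i * (j * (1 - b) ^ (j - 1))) b := by
  have h := ((hasDerivAt_pow i b).const_mul c).mul (((hasDerivAt_id b).const_sub 1).pow j)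
  refine h.congr_deriv ?_
  simp only [id_eq, Pi.pow_apply]
  ring

/-- for `k < m`, the map `b ↦ P(m,k,b)` is differentiable on `(0,1)` with
derivative `-(m-k) C(m,k) b^k (1-b)^(m-k-1)` at every `b ∈ (0,1)`. -/
theorem binTail_hasDerivAt (m k : ℕ) (hkm : k < m) :
    ∀ b ∈ Set.Ioo (0 : ℝ) 1,
      HasDerivAt (fun b => binTail m k b)
        (-(((m - k : ℕ) : ℝ) * (m.choose k : ℝ) * b ^ k * (1 - b) ^ (m - k - 1))) b := by
  intro b _
  induction k with
  | zero =>
    have h := hasDerivAt_const_mul_pow_mul_one_sub_pow 1 0 m b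
    simpa [binTail] using h
  | succ k ih =>
    obtain ⟨d, rfl⟩ := Nat.exists_eq_add_of_lt hkm
    have h := (ih (by omega)).add (hasDerivAt_const_mul_pow_mul_one_sub_pow
      ((k + 1 + d + 1).choose (k + 1)) (k + 1) (d + 1) b)
    have hc := Nat.choose_succ_right_eq (k + 1 + d + 1) k
    have e₁ : k + 1 + d + 1 - k = d + 2 := by omega
    have e₂ : k + 1 + d + 1 - (k + 1) = d + 1 := by omega
    rw [e₁] at h hc
    rw [e₂]
    have hc' : ((k + 1 + d + 1).choose (k + 1) : ℝ) * (k + 1)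
        = (k + 1 + d + 1).choose k * (d + 2) := by exact_mod_cast hc
    refine (h.congr_deriv ?_).congr_of_eventuallyEq (.of_forall fun x => ?_)
    · simp only [Nat.add_sub_cancel, show d + 2 - 1 = d + 1 by omega]
      push_cast
      linear_combination b ^ k * (1 - b) ^ (d + 1) * hc'
    · simp only [binTail, Pi.add_apply]
      rw [Finset.sum_range_succ _ (k + 1), e₂]
end

section
/- Fix integers m and k with k + 1 < m, and let δ ∈ (0,1). Suppose b, b' ∈ (0,1) satisfy P(m,k,b) = δ and P(m,k+1,b') = δ, where P(n,k,b) := Σ_{j=0}^{k} C(n,j)·b^j·(1−b)^{n−j}. Then b < b'. (The risk bound B*(k, δ) is strictly increasing in the number of observed errors k, which underlies the correctness of the binary search in the SGR algorithm.) -/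
theorem binTail_succ_right (n k : ℕ) (b : ℝ) :
    binTail n (k + 1) b =
      binTail n k b + (n.choose (k + 1) : ℝ) * b ^ (k + 1) * (1 - b) ^ (n - (k + 1)) :=
  Finset.sum_range_succ _ _

theorem binTail_succ_left (n k : ℕ) (b : ℝ) :
    binTail (n + 1) k b =
      binTail n k b - b * ((n.choose k : ℝ) * b ^ k * (1 - b) ^ (n - k)) := by
  induction k with
  | zero => simp [binTail]; ring
  | succ k ih =>
    rw [binTail_succ_right, binTail_succ_right, ih, Nat.choose_succ_succ, Nat.add_sub_add_right]
    push_cast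
    rcases lt_or_ge k n with hk | hk
    · obtain ⟨d, rfl⟩ := Nat.exists_eq_add_of_lt hk
      rw [show k + d + 1 - k = d + 1 by lia, show k + d + 1 - (k + 1) = d by lia]
      ring
    · rw [Nat.choose_eq_zero_of_lt (show n < k + 1 by lia)]
      push_cast
      ring

/-- Pascal-type recursion: condition on the outcome of one trial. -/
theorem binTail_succ_succ (n k : ℕ) (b : ℝ) :
    binTail (n + 1) (k + 1) b = (1 - b) * binTail n (k + 1) b + b * binTail n k b := by
  rw [binTail_succ_left, binTail_succ_right]
  ring

theorem binTail_le_succ_right (n k : ℕ) {b : ℝ} (hb : b ∈ Set.Icc (0 : ℝ) 1) :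
    binTail n k b ≤ binTail n (k + 1) b := by
  have h0 : 0 ≤ b := hb.1
  have h1 : 0 ≤ 1 - b := sub_nonneg.2 hb.2
  rw [binTail_succ_right]
  exact le_add_of_nonneg_right (by positivity)

theorem binTail_lt_succ_right {n k : ℕ} (hk : k + 1 ≤ n) {b : ℝ} (hb : b ∈ Set.Ioo (0 : ℝ) 1) :
    binTail n k b < binTail n (k + 1) b := by
  have h0 : 0 < b := hb.1
  have h1 : 0 < 1 - b := sub_pos.2 hb.2
  have hc : (0 : ℝ) < n.choose (k + 1) := by exact_mod_cast Nat.choose_pos hk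
  rw [binTail_succ_right]
  exact lt_add_of_pos_right _ (by positivity)

theorem binTail_antitoneOn (n k : ℕ) : AntitoneOn (binTail n k) (Set.Icc 0 1) := by
  induction n generalizing k with
  | zero =>
    intro x _ y _ _
    simp [binTail, Finset.sum_range_succ']
  | succ n ih =>
    intro x hx y hy hxy
    cases k with
    | zero =>
      simpa [binTail] using pow_le_pow_left₀ (sub_nonneg.2 hy.2) (sub_le_sub_left hxy 1) (n + 1)
    | succ k =>
      rw [binTail_succ_succ, binTail_succ_succ]
      have hA := mul_le_mul_of_nonneg_left (ih (k + 1) hx hy hxy) (sub_nonneg.2 hy.2)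
      have hB := mul_le_mul_of_nonneg_left (ih k hx hy hxy) hy.1
      have hAB := mul_nonneg (sub_nonneg.2 hxy) (sub_nonneg.2 (binTail_le_succ_right n k hx))
      linarith

/-- the bound `B*(k,δ)` is strictly increasing in the number of
observed errors `k`: if `P(m,k,b) = δ` and `P(m,k+1,b') = δ` then `b < b'`. -/
theorem bound_strict_mono_in_k (m k : ℕ) (hkm : k + 1 < m) (δ : ℝ)
    (hδ : δ ∈ Set.Ioo (0 : ℝ) 1) (b b' : ℝ)
    (hb : b ∈ Set.Ioo (0 : ℝ) 1) (hb' : b' ∈ Set.Ioo (0 : ℝ) 1)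
    (h : binTail m k b = δ) (h' : binTail m (k + 1) b' = δ) :
    b < b' := by
  by_contra! hle
  have hanti := binTail_antitoneOn m (k + 1) (Set.Ioo_subset_Icc_self hb')
    (Set.Ioo_subset_Icc_self hb) hle
  have hlt := binTail_lt_succ_right hkm.le hb
  linarith
end

section
/- (Lemma 3.1, Gascuel–Caraux.) Let μ be a probability measure on a measurable space Z, let E ⊆ Z be a measurable set (the 'error event' {z = (x,y) : f(x) ≠ y} of a classifier f) with R := μ(E), let m ≥ 1, and let δ ∈ (0,1). Sample S = (z₁,…,z_m) i.i.d. from μ (i.e., S ~ μ^m) and let K(S) := #{ i : z_i ∈ E } be the number of sampled errors. Let B : {0,1,…,m} → ℝ be any function such that for every k < m, B(k) ∈ (0,1) and Σ_{j=0}^{k} C(m,j)·B(k)^j·(1−B(k))^{m−j} = δ, and B(m) = 1. Then the μ^m-probability of the event { S : R > B(K(S)) } is strictly less than δ. -/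
open MeasureTheory
open scoped Classical ENNReal

theorem hasDerivAt_binTail (k n : ℕ) (b : ℝ) :
    HasDerivAt (binTail (n + k + 1) k)
      (-((n + 1) * ((n + k + 1).choose k : ℝ) * b ^ k * (1 - b) ^ n)) b := by
  have hsub (p : ℕ) : HasDerivAt (fun x : ℝ => (1 - x) ^ p) (-(p * (1 - b) ^ (p - 1))) b := by
    simpa using ((hasDerivAt_id b).const_sub 1).fun_pow p
  induction k generalizing n with
  | zero =>
    have heq : binTail (n + 0 + 1) 0 = fun x : ℝ => (1 - x) ^ (n + 1) := by
      ext x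
      simp [binTail]
    rw [heq]
    simpa using hsub (n + 1)
  | succ k ih =>
    have heq : binTail (n + (k + 1) + 1) (k + 1) = fun x : ℝ => binTail (n + 1 + k + 1) k x +
        ((n + 1 + k + 1).choose (k + 1) : ℝ) * (x ^ (k + 1) * (1 - x) ^ (n + 1)) := by
      ext x
      have h1 : n + (k + 1) + 1 = n + 1 + k + 1 := by omega
      have h2 : n + 1 + k + 1 - (k + 1) = n + 1 := by omega
      rw [h1, binTail, Finset.sum_range_succ, h2, mul_assoc, ← binTail]
    have hchoose : ((n + 1 + k + 1).choose (k + 1) : ℝ) * (k + 1) =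
        (n + 1 + k + 1).choose k * (n + 1 + 1) := by
      have h := Nat.choose_succ_right_eq (n + 1 + k + 1) k
      rw [show n + 1 + k + 1 - k = n + 1 + 1 by omega] at h
      exact_mod_cast h
    rw [heq]
    refine ((ih (n + 1)).fun_add
      (((hasDerivAt_pow (k + 1) b).fun_mul (hsub (n + 1))).const_mul
        ((n + 1 + k + 1).choose (k + 1) : ℝ))).congr_deriv ?_
    rw [show n + (k + 1) + 1 = n + 1 + k + 1 by omega]
    push_cast
    linear_combination (b ^ k * (1 - b) ^ (n + 1)) * hchoose

theorem strictAntiOn_binTail {m k : ℕ} (hk : k < m) :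
    StrictAntiOn (binTail m k) (Set.Icc 0 1) := by
  obtain ⟨n, rfl⟩ : ∃ n, m = n + k + 1 := ⟨m - k - 1, by omega⟩
  refine strictAntiOn_of_deriv_neg (convex_Icc 0 1)
    (fun x _ => (hasDerivAt_binTail k n x).continuousAt.continuousWithinAt) fun x hx => ?_
  rw [interior_Icc] at hx
  have h0 : 0 < x := hx.1
  have h1 : 0 < 1 - x := sub_pos.2 hx.2
  have hc : 0 < ((n + k + 1).choose k : ℝ) := by
    exact_mod_cast Nat.choose_pos (by omega)
  rw [(hasDerivAt_binTail k n x).deriv]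
  exact neg_neg_of_pos (by positivity)

theorem preimage_filter_mem_singleton {Z : Type*} (m : ℕ) (E : Set Z)
    (s : Finset (Fin m)) :
    (fun S : Fin m → Z => Finset.univ.filter fun i => S i ∈ E) ⁻¹' {s} =
      Set.univ.pi fun i => if i ∈ s then E else Eᶜ := by
  ext S
  simp only [Set.mem_preimage, Set.mem_singleton_iff, Finset.ext_iff, Finset.mem_filter,
    Finset.mem_univ, true_and, Set.mem_univ_pi]
  refine forall_congr' fun i => ?_
  split_ifs with h <;> simp [h]

section ErrorCount

variable {Z : Type*} [MeasurableSpace Z] (μ : Measure Z) [IsProbabilityMeasure μ]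
  {E : Set Z} (m : ℕ)

theorem measurableSet_preimage_filter_mem_singleton (hE : MeasurableSet E)
    (s : Finset (Fin m)) :
    MeasurableSet ((fun S : Fin m → Z => Finset.univ.filter fun i => S i ∈ E) ⁻¹' {s}) := by
  rw [preimage_filter_mem_singleton]
  refine MeasurableSet.univ_pi fun i => ?_
  split_ifs
  exacts [hE, hE.compl]

theorem measureReal_pi_filter_mem_eq (hE : MeasurableSet E) (s : Finset (Fin m)) :
    (Measure.pi fun _ : Fin m => μ).real
        ((fun S : Fin m → Z => Finset.univ.filter fun i => S i ∈ E) ⁻¹' {s}) =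
      μ.real E ^ s.card * (1 - μ.real E) ^ (m - s.card) := by
  rw [preimage_filter_mem_singleton, measureReal_def, Measure.pi_pi, ENNReal.toReal_prod]
  simp only [← measureReal_def, apply_ite μ.real, probReal_compl_eq_one_sub hE]
  rw [Finset.prod_ite, Finset.prod_const, Finset.prod_const, Finset.filter_not,
    Finset.card_sdiff_of_subset (Finset.filter_subset _ _)]
  simp

theorem measureReal_pi_card_filter_mem_le (hE : MeasurableSet E) (k : ℕ) :
    (Measure.pi fun _ : Fin m => μ).real
        {S : Fin m → Z | (Finset.univ.filter fun i => S i ∈ E).card ≤ k} =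
      binTail m k (μ.real E) := by
  let t : Finset (Finset (Fin m)) := Finset.univ.filter fun s => s.card ≤ k
  have hset : {S : Fin m → Z | (Finset.univ.filter fun i => S i ∈ E).card ≤ k} =
      (fun S : Fin m → Z => Finset.univ.filter fun i => S i ∈ E) ⁻¹' t := by
    ext S
    simp [t]
  rw [hset, ← sum_measureReal_preimage_singleton t
    fun s _ => measurableSet_preimage_filter_mem_singleton m hE s]
  simp only [measureReal_pi_filter_mem_eq μ m hE]
  rw [binTail, ← Finset.sum_fiberwise_of_maps_to (t := Finset.range (k + 1))
    (g := Finset.card) (by simp [t])]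
  refine Finset.sum_congr rfl fun j hj => ?_
  have hfib : t.filter (fun s => s.card = j) = Finset.powersetCard j Finset.univ := by
    ext s
    have := Finset.mem_range.1 hj
    simp only [t, Finset.mem_filter, Finset.mem_univ, true_and, Finset.mem_powersetCard,
      Finset.subset_univ]
    omega
  rw [hfib, Finset.sum_congr rfl (g := fun _ => μ.real E ^ j * (1 - μ.real E) ^ (m - j))
    fun s hs => by rw [(Finset.mem_powersetCard.1 hs).2]]
  simp [mul_assoc]

end ErrorCount

/-- Lemma 3.1, Gascuel–Caraux: if `E` is the error event of a classifier with
true risk `R = μ(E)`, `S ~ μ^m` with error count `K(S)`, and `B : {0,…,m} → ℝ` satisfies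
`B(k) ∈ (0,1)` with `P(m,k,B(k)) = δ` for `k < m` and `B(m) = 1`, then
`Pr_{S ~ μ^m}{ R > B(K(S)) } < δ`. -/
theorem gascuel_caraux {Z : Type*} [MeasurableSpace Z]
    (μ : Measure Z) [IsProbabilityMeasure μ]
    (E : Set Z) (hE : MeasurableSet E)
    (m : ℕ) (hm : 1 ≤ m) (δ : ℝ) (hδ : δ ∈ Set.Ioo (0 : ℝ) 1)
    (B : ℕ → ℝ)
    (hB : ∀ k < m, B k ∈ Set.Ioo (0 : ℝ) 1 ∧ binTail m k (B k) = δ)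
    (hBm : B m = 1) :
    (Measure.pi fun _ : Fin m => μ)
        {S : Fin m → Z |
          (μ E).toReal > B ((Finset.univ.filter fun i => S i ∈ E).card)}
      < ENNReal.ofReal δ := by
  have hR1 : μ.real E ≤ 1 := measureReal_le_one
  have hR0 : 0 ≤ μ.real E := measureReal_nonneg
  have hlt {S : Fin m → Z} (hS : B ((Finset.univ.filter fun i => S i ∈ E).card) < μ.real E) :
      (Finset.univ.filter fun i => S i ∈ E).card < m := by
    refine lt_of_le_of_ne ((Finset.card_le_univ _).trans_eq (Fintype.card_fin m)) fun h => ?_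
    rw [h, hBm] at hS
    exact hS.not_ge hR1
  let T := (Finset.range m).filter fun k => B k < μ.real E
  rcases T.eq_empty_or_nonempty with hT | hT
  · have hempty : {S : Fin m → Z |
        (μ E).toReal > B ((Finset.univ.filter fun i => S i ∈ E).card)} = ∅ := by
      refine Set.eq_empty_of_forall_notMem fun S hS => ?_
      have hmem : (Finset.univ.filter fun i => S i ∈ E).card ∈ T :=
        Finset.mem_filter.2 ⟨Finset.mem_range.2 (hlt hS), hS⟩
      simp [hT] at hmem
    rw [hempty, measure_empty]
    exact ENNReal.ofReal_pos.2 hδ.1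
  · obtain ⟨hk, hBk⟩ := Finset.mem_filter.1 (T.max'_mem hT)
    have hkm := Finset.mem_range.1 hk
    obtain ⟨⟨hB0, hB1⟩, hBδ⟩ := hB _ hkm
    have hsub : {S : Fin m → Z |
        (μ E).toReal > B ((Finset.univ.filter fun i => S i ∈ E).card)} ⊆
        {S | (Finset.univ.filter fun i => S i ∈ E).card ≤ T.max' hT} := fun S hS =>
      T.le_max' _ (Finset.mem_filter.2 ⟨Finset.mem_range.2 (hlt hS), hS⟩)
    refine (measure_mono hsub).trans_lt ?_
    rw [← ofReal_measureReal, ENNReal.ofReal_lt_ofReal_iff hδ.1,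
      measureReal_pi_card_filter_mem_le μ m hE, ← hBδ]
    exact strictAntiOn_binTail hkm ⟨hB0.le, hB1.le⟩ ⟨hR0, hR1⟩ hBk
end

section
/- Let μ be a probability measure on a measurable space Z, let A ⊆ Z be measurable, let m ≥ 1, and let I ⊆ {1,…,m}. Consider the event E_I := { (z₁,…,z_m) : z_i ∈ A for all i ∈ I and z_i ∉ A for all i ∉ I } in Z^m, and assume μ^m(E_I) > 0. Then the pushforward, under the projection (z₁,…,z_m) ↦ (z_i)_{i∈I}, of the conditional measure μ^m( · | E_I ) equals the product measure ⊗_{i∈I} μ(·|A), where μ(·|A) is μ conditioned on A. (Conditioned on which sample points are accepted by a selection function, the accepted points are i.i.d. from the projected distribution; this is the key sampling fact used in the proof of Theorem 3.2.) -/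
open MeasureTheory ProbabilityTheory

/-- Conditioning a finite product of finite measures on a measurable box is the product of the
conditioned measures. -/
lemma cond_pi_univ_pi {ι : Type*} [Fintype ι] {α : ι → Type*} [∀ i, MeasurableSpace (α i)]
    (μ : ∀ i, Measure (α i)) [∀ i, IsFiniteMeasure (μ i)] {F : ∀ i, Set (α i)}
    (hF : ∀ i, MeasurableSet (F i)) (hF0 : ∀ i, μ i (F i) ≠ 0) :
    (Measure.pi μ)[|Set.univ.pi F] = Measure.pi fun i => (μ i)[|F i] := by
  refine (Measure.pi_eq fun s _ => ?_).symm
  rw [cond_apply (MeasurableSet.univ_pi hF), ← Set.pi_inter_distrib, Measure.pi_pi,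
    Measure.pi_pi, ENNReal.prod_inv_distrib fun i _ j _ _ => Or.inl (hF0 i),
    ← Finset.prod_mul_distrib]
  exact Finset.prod_congr rfl fun i _ => (cond_apply (hF i) _ _).symm

/-- The marginal of a finite product of probability measures on a subset of the coordinates is
the product of the corresponding measures. -/
lemma map_finset_restrict_pi {ι : Type*} [Fintype ι] {α : ι → Type*}
    [∀ i, MeasurableSpace (α i)] (μ : ∀ i, Measure (α i)) [∀ i, IsProbabilityMeasure (μ i)]
    (I : Finset ι) :
    (Measure.pi μ).map (fun S (i : I) => S i) = Measure.pi fun i : I => μ i := by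
  classical
  refine (Measure.pi_eq fun s hs => ?_).symm
  rw [Measure.map_apply (by fun_prop) (MeasurableSet.univ_pi hs)]
  have hpre : (fun (S : ∀ i, α i) (i : I) => S i) ⁻¹' Set.univ.pi s =
      Set.univ.pi fun i => if h : i ∈ I then s ⟨i, h⟩ else Set.univ := by
    ext S
    simp only [Set.mem_preimage, Set.mem_univ_pi]
    refine ⟨fun h i => ?_, fun h i => by simpa using h i⟩
    by_cases hi : i ∈ I
    · simpa [hi] using h ⟨i, hi⟩
    · simp [hi]
  rw [hpre, Measure.pi_pi, ← Finset.prod_subset (Finset.subset_univ I), ← Finset.prod_coe_sort]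
  · simp
  · intro i _ hi
    simp [hi]

/-- conditioned on which sample points are accepted (the set `I`), the
accepted points are i.i.d. from the projected (conditional) distribution `μ(·|A)`:
the pushforward of `μ^m(· | E_I)` under the projection `(z₁,…,z_m) ↦ (z_i)_{i ∈ I}`
is the product measure `⊗_{i ∈ I} μ(·|A)`. -/
theorem accepted_points_iid_conditional {Z : Type*} [MeasurableSpace Z]
    (μ : Measure Z) [IsProbabilityMeasure μ]
    (A : Set Z) (hA : MeasurableSet A)
    (m : ℕ) (hm : 1 ≤ m) (I : Finset (Fin m))
    (E : Set (Fin m → Z))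
    (hE : E = {S | ∀ i : Fin m, (i ∈ I → S i ∈ A) ∧ (i ∉ I → S i ∉ A)})
    (hpos : 0 < (Measure.pi fun _ : Fin m => μ) E) :
    Measure.map (fun (S : Fin m → Z) (i : I) => S i)
        ((Measure.pi fun _ : Fin m => μ)[|E])
      = Measure.pi (fun _ : I => μ[|A]) := by
  classical
  set F : Fin m → Set Z := fun i => if i ∈ I then A else Aᶜ with hF
  have hFm : ∀ i, MeasurableSet (F i) := by
    intro i
    by_cases h : i ∈ I <;> simp [hF, h, hA, hA.compl]
  have hEF : E = Set.univ.pi F := by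
    rw [hE]
    ext S
    simp only [Set.mem_ofPred_eq, Set.mem_univ_pi]
    refine forall_congr' fun i => ?_
    by_cases h : i ∈ I <;> simp [hF, h]
  rw [hEF, Measure.pi_pi] at hpos
  have hF0 : ∀ i, μ (F i) ≠ 0 := fun i =>
    Finset.prod_ne_zero_iff.mp hpos.ne' i (Finset.mem_univ i)
  have (i : Fin m) : IsProbabilityMeasure (μ[|F i]) := cond_isProbabilityMeasure (hF0 i)
  rw [hEF, cond_pi_univ_pi (fun _ => μ) hFm hF0, map_finset_restrict_pi]
  congr 1
  ext1 i
  simp [hF]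
end

section
/- Let μ be a probability measure on a measurable space Z, and let B ⊆ A ⊆ Z be measurable sets with μ(A) > 0; set r := μ(B)/μ(A). Let m ≥ 1 and δ ∈ (0,1). Sample S = (z₁,…,z_m) ~ μ^m and define N(S) := #{ i : z_i ∈ A } and K(S) := #{ i : z_i ∈ B }. Then the μ^m-probability of the event { S : Σ_{j=0}^{K(S)} C(N(S),j)·r^j·(1−r)^{N(S)−j} < δ } is strictly less than δ. (High-probability risk guarantee for a single fixed selection function with a random number of accepted samples; this is the per-iteration claim, inequality (5), in the proof of Theorem 3.2.) -/
open MeasureTheory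
open scoped Classical ENNReal

theorem sum_lt_of_binTail_lt (n : ℕ) {r δ : ℝ} (hr₀ : 0 ≤ r) (hr₁ : r ≤ 1) (hδ : 0 < δ) :
    ∑ j ∈ Finset.range (n + 1) with binTail n j r < δ,
      (n.choose j : ℝ) * r ^ j * (1 - r) ^ (n - j) < δ := by
  rcases (Finset.filter (fun j => binTail n j r < δ) (Finset.range (n + 1))).eq_empty_or_nonempty
    with h | h
  · rwa [h, Finset.sum_empty]
  · have hmax := (Finset.mem_filter.1 (Finset.max'_mem _ h)).2
    refine lt_of_le_of_lt ?_ hmax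
    refine Finset.sum_le_sum_of_subset_of_nonneg (fun j hj => ?_) fun j _ _ => ?_
    · exact Finset.mem_range_succ_iff.2 (Finset.le_max' _ j hj)
    · have := sub_nonneg.2 hr₁
      positivity

theorem sum_powerset_lt_of_binTail_lt {ι : Type*} (T : Finset ι) {r δ : ℝ} (hr₀ : 0 ≤ r)
    (hr₁ : r ≤ 1) (hδ : 0 < δ) :
    ∑ E ∈ T.powerset with binTail T.card E.card r < δ,
      r ^ E.card * (1 - r) ^ (T.card - E.card) < δ := by
  rw [Finset.sum_filter, Finset.sum_powerset_apply_card
    (fun j => if binTail T.card j r < δ then r ^ j * (1 - r) ^ (T.card - j) else 0)]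
  convert sum_lt_of_binTail_lt T.card hr₀ hr₁ hδ using 1
  rw [Finset.sum_filter]
  refine Finset.sum_congr rfl fun j _ => ?_
  split_ifs <;> simp [mul_assoc]

/-- The probability that an i.i.d. sample hits `A` exactly on `T` and `B` exactly on `E`. -/
theorem pi_real_setOf_filter_eq {Z ι : Type*} [Fintype ι] [MeasurableSpace Z] (μ : Measure Z)
    [IsProbabilityMeasure μ] {A B : Set Z} (hA : MeasurableSet A) (hB : MeasurableSet B)
    (hBA : B ⊆ A) {T E : Finset ι} (hET : E ⊆ T) :
    (Measure.pi fun _ : ι => μ).real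
        {S | (Finset.univ.filter fun i => S i ∈ A) = T ∧
          (Finset.univ.filter fun i => S i ∈ B) = E} =
      μ.real B ^ E.card * (μ.real A - μ.real B) ^ (T.card - E.card) *
        (1 - μ.real A) ^ (Fintype.card ι - T.card) := by
  have hset : {S : ι → Z | (Finset.univ.filter fun i => S i ∈ A) = T ∧
      (Finset.univ.filter fun i => S i ∈ B) = E} =
      Set.univ.pi fun i => if i ∈ E then B else if i ∈ T then A \ B else Aᶜ := by
    ext S
    simp only [Set.mem_ofPred_eq, Finset.ext_iff, Finset.mem_filter, Finset.mem_univ, true_and,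
      Set.mem_univ_pi, ← forall_and]
    refine forall_congr' fun i => ?_
    have h₁ := @hBA (S i)
    have h₂ := @hET i
    split_ifs <;> simp_all
    tauto
  have hval : ∀ i, μ.real (if i ∈ E then B else if i ∈ T then A \ B else Aᶜ) =
      if i ∈ E then μ.real B else if i ∈ T then μ.real A - μ.real B else 1 - μ.real A := by
    intro i
    split_ifs
    · rfl
    · exact measureReal_sdiff hBA hB
    · exact probReal_compl_eq_one_sub hA
  rw [hset, measureReal_def, Measure.pi_pi, ENNReal.toReal_prod]
  simp only [← measureReal_def, hval]
  rw [Finset.prod_ite, Finset.prod_ite]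
  simp only [Finset.prod_const, Finset.filter_filter]
  have h₁ : (Finset.univ.filter fun i => i ∈ E) = E := by ext; simp
  have h₂ : (Finset.univ.filter fun i => i ∉ E ∧ i ∈ T) = T \ E := by ext; simp [and_comm]
  have h₃ : (Finset.univ.filter fun i => i ∉ E ∧ i ∉ T) = Tᶜ := by
    ext i
    have := @hET i
    simp only [Finset.mem_filter, Finset.mem_univ, true_and, Finset.mem_compl]
    tauto
  rw [h₁, h₂, h₃, Finset.card_sdiff_of_subset hET, Finset.card_compl, mul_assoc]

/-- inequality (5) in the proof of Theorem 3.2: for a single fixed selection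
function with acceptance event `A` and accepted-error event `B ⊆ A`, selective risk
`r = μ(B)/μ(A)`, number of accepted points `N(S)` and accepted errors `K(S)` on an i.i.d.
sample `S ~ μ^m`, we have `Pr_{S ~ μ^m}{ P(N(S), K(S), r) < δ } < δ`. -/
theorem per_iteration_risk_guarantee {Z : Type*} [MeasurableSpace Z]
    (μ : Measure Z) [IsProbabilityMeasure μ]
    (A B : Set Z) (hA : MeasurableSet A) (hB : MeasurableSet B) (hBA : B ⊆ A)
    (hApos : 0 < μ A)
    (r : ℝ) (hr : r = (μ B).toReal / (μ A).toReal)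
    (m : ℕ) (hm : 1 ≤ m) (δ : ℝ) (hδ : δ ∈ Set.Ioo (0 : ℝ) 1) :
    (Measure.pi fun _ : Fin m => μ)
        {S : Fin m → Z |
          binTail ((Finset.univ.filter fun i => S i ∈ A).card)
            ((Finset.univ.filter fun i => S i ∈ B).card) r < δ}
      < ENNReal.ofReal δ := by
  have ha : 0 < μ.real A := ENNReal.toReal_pos hApos.ne' (measure_ne_top μ A)
  have ha₁ : 0 ≤ 1 - μ.real A := sub_nonneg.2 measureReal_le_one
  have hr₀ : 0 ≤ r := hr ▸ by positivity
  have hr₁ : r ≤ 1 := hr ▸ div_le_one_of_le₀ (measureReal_mono hBA) ha.le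
  have hb : μ.real B = μ.real A * r := by
    rw [hr, ← measureReal_def, ← measureReal_def, mul_div_cancel₀ _ ha.ne']
  let w : Finset (Fin m) → ℝ := fun T => μ.real A ^ T.card * (1 - μ.real A) ^ (m - T.card)
  let I : Finset (Fin m) → Finset (Finset (Fin m)) := fun T =>
    T.powerset.filter fun E => binTail T.card E.card r < δ
  let cell : Finset (Fin m) → Finset (Fin m) → Set (Fin m → Z) := fun T E =>
    {S | (Finset.univ.filter fun i => S i ∈ A) = T ∧ (Finset.univ.filter fun i => S i ∈ B) = E}
  have hcell : ∀ T, ∀ E ∈ I T, (Measure.pi fun _ : Fin m => μ).real (cell T E) =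
      w T * (r ^ E.card * (1 - r) ^ (T.card - E.card)) := by
    intro T E hE
    have hET := Finset.mem_powerset.1 (Finset.mem_filter.1 hE).1
    have hcard : μ.real A ^ T.card = μ.real A ^ E.card * μ.real A ^ (T.card - E.card) := by
      rw [← pow_add, Nat.add_sub_cancel' (Finset.card_le_card hET)]
    have hsub : μ.real A - μ.real A * r = μ.real A * (1 - r) := by ring
    simp only [cell, w]
    rw [pi_real_setOf_filter_eq μ hA hB hBA hET, hb, Fintype.card_fin, hcard, hsub,
      mul_pow, mul_pow]
    ring
  have hw : ∀ T, 0 ≤ w T := fun T => by positivity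
  have hw_sum : ∑ T, w T = 1 := by
    have := Fintype.sum_pow_mul_eq_add_pow (Fin m) (μ.real A) (1 - μ.real A)
    simpa [w] using this
  rw [← ofReal_measureReal, ENNReal.ofReal_lt_ofReal_iff hδ.1]
  calc _ ≤ (Measure.pi fun _ : Fin m => μ).real
        (⋃ T ∈ (Finset.univ : Finset (Finset (Fin m))), ⋃ E ∈ I T, cell T E) := by
        refine measureReal_mono (fun S hS => ?_) (measure_ne_top _ _)
        simp only [Set.mem_iUnion]
        refine ⟨Finset.univ.filter fun i => S i ∈ A, Finset.mem_univ _,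
          Finset.univ.filter fun i => S i ∈ B, Finset.mem_filter.2 ⟨?_, hS⟩, rfl, rfl⟩
        exact Finset.mem_powerset.2 (Finset.monotone_filter_right _ fun i _ hi => hBA hi)
    _ ≤ ∑ T, ∑ E ∈ I T, (Measure.pi fun _ : Fin m => μ).real (cell T E) :=
        (measureReal_biUnion_finset_le _ _).trans
          (Finset.sum_le_sum fun T _ => measureReal_biUnion_finset_le _ _)
    _ = ∑ T, w T * ∑ E ∈ I T, r ^ E.card * (1 - r) ^ (T.card - E.card) :=
        Finset.sum_congr rfl fun T _ => by rw [Finset.sum_congr rfl (hcell T), Finset.mul_sum]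
    _ < ∑ T, w T * δ := by
        refine Finset.sum_lt_sum (fun T _ => mul_le_mul_of_nonneg_left
          (sum_powerset_lt_of_binTail_lt T hr₀ hr₁ hδ.1).le (hw T))
          ⟨Finset.univ, Finset.mem_univ _, mul_lt_mul_of_pos_left
            (sum_powerset_lt_of_binTail_lt _ hr₀ hr₁ hδ.1) ?_⟩
        simp only [w, Finset.card_univ, Fintype.card_fin, Nat.sub_self, pow_zero, mul_one]
        positivity
    _ = δ := by rw [← Finset.sum_mul, hw_sum, one_mul]
end

section
/- (Theorem 3.2, SGR uniform convergence, stated for a family of selection functions.) Let μ be a probability measure on a measurable space Z, let k ≥ 1, and for each i ∈ {1,…,k} let B_i ⊆ A_i ⊆ Z be measurable sets with μ(A_i) > 0; set r_i := μ(B_i)/μ(A_i). Let m ≥ 1 and δ ∈ (0,1). Sample S = (z₁,…,z_m) ~ μ^m and define N_i(S) := #{ j : z_j ∈ A_i } and K_i(S) := #{ j : z_j ∈ B_i }. Then the μ^m-probability of the event { S : ∃ i ∈ {1,…,k}, Σ_{j=0}^{K_i(S)} C(N_i(S),j)·r_i^j·(1−r_i)^{N_i(S)−j} < δ/k } is strictly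 less than δ. (Equivalently, with probability at least 1−δ, simultaneously for all i the true selective risk r_i = R(f | P_{g_i}) is at most the bound B*(K_i, δ/k) computed from N_i accepted samples, as in the k = ⌈log₂ m⌉ iterations of the SGR algorithm.) -/
open MeasureTheory
open scoped Classical ENNReal

/-- The binomial CDF as a sum over the subsets of a finite set. -/
lemma sum_powerset_card_le_eq_binTail {ι : Type*} (T : Finset ι) {K : ℕ} (hK : K ≤ T.card)
    (r : ℝ) :
    ∑ U ∈ T.powerset with U.card ≤ K, r ^ U.card * (1 - r) ^ (T.card - U.card)
      = binTail T.card K r := by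
  rw [Finset.sum_filter, Finset.sum_powerset_apply_card
    (fun j => if j ≤ K then r ^ j * (1 - r) ^ (T.card - j) else 0), binTail]
  simp only [nsmul_eq_mul, mul_ite, mul_zero, ← Finset.sum_filter, mul_assoc]
  refine Finset.sum_congr ?_ fun _ _ => rfl
  ext j
  simp only [Finset.mem_filter, Finset.mem_range]
  omega

/-- A binomial variable falls below the `t`-quantile of its CDF with probability less than `t`. -/
lemma sum_powerset_binTail_lt {ι : Type*} (T : Finset ι) {r t : ℝ} (hr0 : 0 ≤ r) (hr1 : r ≤ 1)
    (ht : 0 < t) :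
    ∑ U ∈ T.powerset with binTail T.card U.card r < t,
      r ^ U.card * (1 - r) ^ (T.card - U.card) < t := by
  rcases (T.powerset.filter fun U => binTail T.card U.card r < t).eq_empty_or_nonempty with h | h
  · simpa [h] using ht
  obtain ⟨V, hV, hmax⟩ := Finset.exists_max_image _ Finset.card h
  rw [Finset.mem_filter, Finset.mem_powerset] at hV
  refine lt_of_le_of_lt ?_ hV.2
  rw [← sum_powerset_card_le_eq_binTail T (Finset.card_le_card hV.1)]
  have h1 : 0 ≤ 1 - r := sub_nonneg.2 hr1
  refine Finset.sum_le_sum_of_subset_of_nonneg (fun U hU => ?_) fun _ _ _ => by positivity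
  exact Finset.mem_filter.2 ⟨(Finset.mem_filter.1 hU).1, hmax U hU⟩

lemma prod_ite_ite_eq_pow_card {ι : Type*} [Fintype ι] {U T : Finset ι} (hUT : U ⊆ T)
    (a r : ℝ) :
    ∏ j, (if j ∈ U then a * r else if j ∈ T then a * (1 - r) else 1 - a)
      = (a ^ T.card * (1 - a) ^ (Fintype.card ι - T.card))
        * (r ^ U.card * (1 - r) ^ (T.card - U.card)) := by
  have hsplit : ∀ j, (if j ∈ U then a * r else if j ∈ T then a * (1 - r) else 1 - a)
      = (if j ∈ T then a else 1 - a) * (if j ∈ T then (if j ∈ U then r else 1 - r) else 1) := by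
    intro j
    by_cases hU : j ∈ U
    · simp [hU, hUT hU]
    · by_cases hT : j ∈ T <;> simp [hU, hT]
  simp only [hsplit, Finset.prod_mul_distrib]
  congr 1
  · rw [Finset.prod_ite, Finset.prod_const, Finset.prod_const, Finset.filter_mem_eq_inter,
      Finset.univ_inter, ← Finset.card_compl]
    congr 3
    ext; simp
  · rw [Finset.prod_ite_mem, Finset.univ_inter, Finset.prod_ite, Finset.prod_const,
      Finset.prod_const, Finset.filter_mem_eq_inter, Finset.inter_eq_right.2 hUT,
      ← Finset.card_sdiff_of_subset hUT]
    congr 3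
    ext; simp

/-- The probability that exactly the sample points in `T` fall in `A` and exactly those in `U`
fall in `B`. -/
lemma measureReal_pi_filter_eq {Z ι : Type*} [MeasurableSpace Z] [Fintype ι]
    (μ : Measure Z) [IsProbabilityMeasure μ] {A B : Set Z} (hA : MeasurableSet A)
    (hB : MeasurableSet B) (hBA : B ⊆ A) {r : ℝ} (hr : μ.real B = μ.real A * r)
    {U T : Finset ι} (hUT : U ⊆ T) :
    (Measure.pi fun _ : ι => μ).real
        {S | (Finset.univ.filter fun j => S j ∈ A) = T ∧
          (Finset.univ.filter fun j => S j ∈ B) = U}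
      = (μ.real A ^ T.card * (1 - μ.real A) ^ (Fintype.card ι - T.card))
        * (r ^ U.card * (1 - r) ^ (T.card - U.card)) := by
  have hbox : {S : ι → Z | (Finset.univ.filter fun j => S j ∈ A) = T ∧
      (Finset.univ.filter fun j => S j ∈ B) = U}
      = Set.univ.pi fun j => if j ∈ U then B else if j ∈ T then A \ B else Aᶜ := by
    ext S
    simp only [Set.mem_ofPred_eq, Finset.ext_iff, Finset.mem_filter, Finset.mem_univ, true_and,
      Set.mem_pi, Set.mem_univ, true_implies, ← forall_and]
    refine forall_congr' fun j => ?_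
    have h1 := @hBA (S j)
    have h2 := @hUT j
    by_cases hU : j ∈ U
    · simp only [hU, h2 hU, if_true, iff_true]
      tauto
    · by_cases hT : j ∈ T <;> simp only [hU, hT, if_true, if_false, Set.mem_sdiff,
        Set.mem_compl_iff] <;> tauto
  rw [hbox, ← prod_ite_ite_eq_pow_card hUT, measureReal_def, Measure.pi_pi, ENNReal.toReal_prod]
  refine Finset.prod_congr rfl fun j _ => ?_
  rw [← measureReal_def]
  split_ifs
  · exact hr
  · rw [measureReal_sdiff hBA hB, hr]
    ring
  · exact probReal_compl_eq_one_sub hA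

lemma measureReal_pi_binTail_lt {Z ι : Type*} [MeasurableSpace Z] [Fintype ι]
    (μ : Measure Z) [IsProbabilityMeasure μ] {A B : Set Z} (hA : MeasurableSet A)
    (hB : MeasurableSet B) (hBA : B ⊆ A) (hApos : 0 < μ.real A) {t : ℝ} (ht : 0 < t) :
    (Measure.pi fun _ : ι => μ).real
        {S | binTail ((Finset.univ.filter fun j => S j ∈ A).card)
          ((Finset.univ.filter fun j => S j ∈ B).card) (μ.real B / μ.real A) < t} < t := by
  set a := μ.real A
  set r := μ.real B / a
  have hr0 : 0 ≤ r := by positivity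
  have hr1 : r ≤ 1 := (div_le_one hApos).2 (measureReal_mono hBA)
  have hr : μ.real B = a * r := (mul_div_cancel₀ _ hApos.ne').symm
  have ha1 : 0 ≤ 1 - a := sub_nonneg.2 measureReal_le_one
  set w : Finset ι → ℝ := fun T => a ^ T.card * (1 - a) ^ (Fintype.card ι - T.card)
  have hw : ∀ T, 0 ≤ w T := fun T => by positivity
  have hw_sum : ∑ T, w T = 1 := by
    rw [Fintype.sum_pow_mul_eq_add_pow]
    simp
  set s : Finset ι → Finset (Finset ι) := fun T =>
    T.powerset.filter fun U => binTail T.card U.card r < t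
  set E : Finset ι → Finset ι → Set (ι → Z) := fun T U =>
    {S | (Finset.univ.filter fun j => S j ∈ A) = T ∧ (Finset.univ.filter fun j => S j ∈ B) = U}
  calc _ ≤ (Measure.pi fun _ : ι => μ).real (⋃ T ∈ Finset.univ, ⋃ U ∈ s T, E T U) := by
        refine measureReal_mono (fun S hS => ?_) (measure_ne_top _ _)
        simp only [Set.mem_iUnion]
        refine ⟨_, Finset.mem_univ _, _, ?_, rfl, rfl⟩
        refine Finset.mem_filter.2 ⟨Finset.mem_powerset.2 ?_, hS⟩
        exact Finset.monotone_filter_right _ fun j _ hj => hBA hj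
    _ ≤ ∑ T, ∑ U ∈ s T, (Measure.pi fun _ : ι => μ).real (E T U) :=
        (measureReal_biUnion_finset_le _ _).trans
          (Finset.sum_le_sum fun T _ => measureReal_biUnion_finset_le _ _)
    _ = ∑ T, w T * ∑ U ∈ s T, r ^ U.card * (1 - r) ^ (T.card - U.card) := by
        refine Finset.sum_congr rfl fun T _ => ?_
        rw [Finset.mul_sum]
        refine Finset.sum_congr rfl fun U hU => ?_
        exact measureReal_pi_filter_eq μ hA hB hBA hr
          (Finset.mem_powerset.1 (Finset.mem_filter.1 hU).1)
    _ < ∑ T, w T * t := by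
        refine Finset.sum_lt_sum (fun T _ => mul_le_mul_of_nonneg_left
          (sum_powerset_binTail_lt T hr0 hr1 ht).le (hw T)) ⟨Finset.univ, Finset.mem_univ _, ?_⟩
        refine mul_lt_mul_of_pos_left (sum_powerset_binTail_lt _ hr0 hr1 ht) ?_
        simpa [w] using pow_pos hApos _
    _ = t := by rw [← Finset.sum_mul, hw_sum, one_mul]

/-- Theorem 3.2, SGR uniform convergence: for a family of `k` selection
functions with acceptance events `A i`, accepted-error events `B i ⊆ A i` and selective
risks `r i = μ(B i)/μ(A i)`, on an i.i.d. sample `S ~ μ^m` with counts `Nᵢ(S)`, `Kᵢ(S)`,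
`Pr_{S ~ μ^m}{ ∃ i, P(Nᵢ(S), Kᵢ(S), r i) < δ/k } < δ`. -/
theorem sgr_uniform_convergence {Z : Type*} [MeasurableSpace Z]
    (μ : Measure Z) [IsProbabilityMeasure μ]
    (k : ℕ) (hk : 1 ≤ k)
    (A B : Fin k → Set Z)
    (hA : ∀ i, MeasurableSet (A i)) (hB : ∀ i, MeasurableSet (B i))
    (hBA : ∀ i, B i ⊆ A i) (hApos : ∀ i, 0 < μ (A i))
    (r : Fin k → ℝ) (hr : ∀ i, r i = (μ (B i)).toReal / (μ (A i)).toReal)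
    (m : ℕ) (hm : 1 ≤ m) (δ : ℝ) (hδ : δ ∈ Set.Ioo (0 : ℝ) 1) :
    (Measure.pi fun _ : Fin m => μ)
        {S : Fin m → Z | ∃ i : Fin k,
          binTail ((Finset.univ.filter fun j => S j ∈ A i).card)
            ((Finset.univ.filter fun j => S j ∈ B i).card) (r i) < δ / k}
      < ENNReal.ofReal δ := by
  have hk0 : (0 : ℝ) < k := by exact_mod_cast hk
  have : Nonempty (Fin k) := ⟨⟨0, hk⟩⟩
  rw [ENNReal.lt_ofReal_iff_toReal_lt (measure_ne_top _ _), ← measureReal_def, Set.ofPred_exists]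
  refine (measureReal_iUnion_fintype_le _).trans_lt ?_
  have hsum : ∑ _i : Fin k, δ / (k : ℝ) = δ := by
    rw [Finset.sum_const, Finset.card_univ, Fintype.card_fin, nsmul_eq_mul,
      mul_div_cancel₀ _ hk0.ne']
  refine (Finset.sum_lt_sum_of_nonempty Finset.univ_nonempty fun i _ => ?_).trans_eq hsum
  rw [hr i]
  exact measureReal_pi_binTail_lt μ (hA i) (hB i) (hBA i)
    (ENNReal.toReal_pos (hApos i).ne' (measure_ne_top _ _)) (div_pos hδ.1 hk0)
end
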